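/- Let G be a graph on n vertices with a centroidal locating set B of size k, and let D ≥ 1 be an integer such that d(u,b) ≤ D for every u ∈ V(G)\B and every b ∈ B. Then n ≤ k + D^k. -/

import Mathlib

open SimpleGraph

/-- A set `B` is a centroidal locating set of `G` if every pair of distinct vertices is
distinguished by the relative distances to two vertices of `B`. -/
def CentroidalLocating {V : Type*} (G : SimpleGraph V) (B : Set V) : Prop :=
  ∀ ⦃x y : V⦄, x ≠ y → ∃ b1 ∈ B, ∃ b2 ∈ B,
    (G.dist x b1 ≤ G.dist x b2 ∧ G.dist y b2 < G.dist y b1) ∨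
    (G.dist y b1 ≤ G.dist y b2 ∧ G.dist x b2 < G.dist x b1)

/-- The centroidal dimension: minimum size of a centroidal locating set. -/
noncomputable def CD {V : Type*} (G : SimpleGraph V) : ℕ :=
  sInf {k | ∃ B : Set V, B.ncard = k ∧ CentroidalLocating G B}

/-- In a graph with a centroidal locating set, the distances to the set determine the vertex. -/
theorem CentroidalLocating.eq_of_dist_eq {V : Type*} {G : SimpleGraph V} {B : Set V}
    (hB : CentroidalLocating G B) {x y : V} (h : ∀ b ∈ B, G.dist x b = G.dist y b) : x = y := by
  by_contra hxy
  obtain ⟨b₁, hb₁, b₂, hb₂, hd⟩ := hB hxy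
  have h₁ := h b₁ hb₁
  have h₂ := h b₂ hb₂
  omega

theorem card_le_add_pow_of_bounded_dist {V : Type*} [Fintype V] (G : SimpleGraph V)
    (hG : G.Connected) (B : Set V) (k D : ℕ) (hk : B.ncard = k) (hD : 1 ≤ D)
    (hB : CentroidalLocating G B)
    (hdist : ∀ u : V, u ∉ B → ∀ b ∈ B, G.dist u b ≤ D) :
    Fintype.card V ≤ k + D ^ k := by
  have hpos (u : (Bᶜ : Set V)) (b : B) : 0 < G.dist u b :=
    hG.pos_dist_of_ne fun h => u.2 (h ▸ b.2)
  let f (u : (Bᶜ : Set V)) (b : B) : Fin D :=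
    ⟨G.dist u b - 1, by have := hpos u b; have := hdist u u.2 b b.2; omega⟩
  have hf : Function.Injective f := by
    intro u v huv
    refine Subtype.ext (hB.eq_of_dist_eq fun b hb => ?_)
    have hval : G.dist u b - 1 = G.dist v b - 1 := congrArg Fin.val (congrFun huv ⟨b, hb⟩)
    have hu := hpos u ⟨b, hb⟩
    have hv := hpos v ⟨b, hb⟩
    dsimp only at hu hv
    omega
  have hcompl : (Bᶜ).ncard ≤ D ^ k := by
    have := Nat.card_le_card_of_injective f hf
    rwa [Nat.card_fun, Nat.card_fin, Nat.card_coe_set_eq, Nat.card_coe_set_eq, hk] at this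
  have hadd := Set.ncard_add_ncard_compl B
  rw [Nat.card_eq_fintype_card] at hadd
  omega
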